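/- Let ρ be a density matrix on H_B ⊗ H_C ⊗ H_D ⊗ H_{D'}. If S(CB)_ρ − S(B)_ρ + S(CD)_ρ − S(D)_ρ = 0, then S(CB)_ρ − S(B)_ρ + S(CDD')_ρ − S(DD')_ρ = 0. -/

import Mathlib

open Matrix BigOperators
open scoped ComplexOrder

/-- A density matrix: a positive semidefinite matrix of trace one. -/
def IsDensityMatrix {n : Type*} [Fintype n] (ρ : Matrix n n ℂ) : Prop :=
  ρ.PosSemidef ∧ ρ.trace = 1

/-- The von Neumann entropy `S(ρ) = -Tr(ρ log ρ)`, computed via the eigenvalues of a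
Hermitian matrix (with the convention `0 log 0 = 0`). -/
noncomputable def vNEntropy {n : Type*} [Fintype n] [DecidableEq n]
    (ρ : Matrix n n ℂ) : ℝ :=
  if h : ρ.IsHermitian then -∑ i, h.eigenvalues i * Real.log (h.eigenvalues i) else 0

/-- `A = U diag(p) Uᴴ` with `U` unitary and `p` real. -/
structure Diagonalizes {n : Type*} [Fintype n] [DecidableEq n]
    (A U : Matrix n n ℂ) (p : n → ℝ) : Prop where
  conj_mul : Uᴴ * U = 1
  eq : A = U * diagonal (fun i => (p i : ℂ)) * Uᴴ

namespace Diagonalizes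

variable {n : Type*} [Fintype n] [DecidableEq n] {A U : Matrix n n ℂ} {p : n → ℝ}

theorem mul_conj (h : Diagonalizes A U p) : U * Uᴴ = 1 :=
  mul_eq_one_comm.mp h.conj_mul

theorem isHermitian (h : Diagonalizes A U p) : A.IsHermitian := by
  rw [Matrix.IsHermitian, h.eq]
  simp only [conjTranspose_mul, conjTranspose_conjTranspose, diagonal_conjTranspose, mul_assoc]
  congr 3
  ext i
  simp

theorem charpoly_roots (h : Diagonalizes A U p) :
    A.charpoly.roots = Multiset.map (fun i => (p i : ℂ)) Finset.univ.val := by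
  rw [h.eq, charpoly_mul_comm, ← mul_assoc, h.conj_mul, one_mul, charpoly_diagonal,
    Polynomial.roots_prod]
  · simp
  · simp [Finset.prod_ne_zero_iff, Polynomial.X_sub_C_ne_zero]

theorem add_smul_one (h : Diagonalizes A U p) (c : ℝ) :
    Diagonalizes (A + (c : ℂ) • 1) U (fun i => p i + c) := by
  refine ⟨h.conj_mul, ?_⟩
  have : diagonal (fun i => ((p i + c : ℝ) : ℂ)) =
      diagonal (fun i => (p i : ℂ)) + (c : ℂ) • (1 : Matrix n n ℂ) := by
    rw [smul_one_eq_diagonal, diagonal_add]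
    simp
  rw [this, mul_add, add_mul, ← h.eq]
  simp [h.mul_conj]

theorem conj_mul_mul (h : Diagonalizes A U p) :
    Uᴴ * A * U = diagonal (fun i => (p i : ℂ)) := by
  rw [h.eq, show Uᴴ * (U * diagonal (fun i => (p i : ℂ)) * Uᴴ) * U =
    (Uᴴ * U) * diagonal (fun i => (p i : ℂ)) * (Uᴴ * U) by simp only [mul_assoc], h.conj_mul]
  simp

end Diagonalizes

theorem Matrix.IsHermitian.diagonalizes {n : Type*} [Fintype n] [DecidableEq n]
    {A : Matrix n n ℂ} (h : A.IsHermitian) :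
    Diagonalizes A (h.eigenvectorUnitary : Matrix n n ℂ) h.eigenvalues := by
  refine ⟨?_, ?_⟩
  · have := Unitary.coe_star_mul_self h.eigenvectorUnitary
    rwa [star_eq_conjTranspose] at this
  · conv_lhs => rw [h.spectral_theorem, Unitary.conjStarAlgAut_apply]
    rfl

theorem vNEntropy_eq_roots {n : Type*} [Fintype n] [DecidableEq n]
    {A : Matrix n n ℂ} (h : A.IsHermitian) :
    vNEntropy A = (A.charpoly.roots.map fun z => Real.negMulLog z.re).sum := by
  rw [vNEntropy, dif_pos h, h.roots_charpoly_eq_eigenvalues, Multiset.map_map,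
    ← Finset.sum_neg_distrib]
  simp [Real.negMulLog]

theorem Diagonalizes.vNEntropy_eq {n : Type*} [Fintype n] [DecidableEq n]
    {A U : Matrix n n ℂ} {p : n → ℝ} (h : Diagonalizes A U p) :
    vNEntropy A = ∑ i, Real.negMulLog (p i) := by
  rw [vNEntropy_eq_roots h.isHermitian, h.charpoly_roots, Multiset.map_map]
  simp

theorem vNEntropy_transpose {n : Type*} [Fintype n] [DecidableEq n]
    {A : Matrix n n ℂ} (h : A.IsHermitian) : vNEntropy Aᵀ = vNEntropy A := by
  rw [vNEntropy_eq_roots h, vNEntropy_eq_roots h.transpose, charpoly_transpose]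

theorem vNEntropy_self_mul_conjTranspose {m n : Type*} [Fintype m] [DecidableEq m]
    [Fintype n] [DecidableEq n] (M : Matrix m n ℂ) :
    vNEntropy (M * Mᴴ) = vNEntropy (Mᴴ * M) := by
  rw [vNEntropy_eq_roots (isHermitian_mul_conjTranspose_self M),
    vNEntropy_eq_roots (isHermitian_conjTranspose_mul_self M)]
  have key := congrArg (fun q => (q.roots.map fun z : ℂ => Real.negMulLog z.re).sum)
    (charpoly_mul_comm' M Mᴴ)
  rw [Polynomial.roots_mul, Polynomial.roots_mul] at key
  · simpa [Multiset.map_nsmul, Multiset.sum_nsmul] using key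
  all_goals
    exact mul_ne_zero (pow_ne_zero _ Polynomial.X_ne_zero) (charpoly_monic _).ne_zero

/-- The two marginals of a pure state have the same entropy. -/
theorem vNEntropy_transpose_mul {m n : Type*} [Fintype m] [DecidableEq m]
    [Fintype n] [DecidableEq n] (M : Matrix m n ℂ) :
    vNEntropy (Mᵀ * Mᵀᴴ) = vNEntropy (M * Mᴴ) := by
  rw [vNEntropy_self_mul_conjTranspose M,
    ← vNEntropy_transpose (isHermitian_conjTranspose_mul_self M), transpose_mul]
  rfl

theorem tendsto_vNEntropy_add {n : Type*} [Fintype n] [DecidableEq n]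
    {A : Matrix n n ℂ} (h : A.IsHermitian) (c : ℝ) :
    Filter.Tendsto (fun ε : ℝ => vNEntropy (A + ((c * ε : ℝ) : ℂ) • 1))
      (nhdsWithin 0 (Set.Ioi 0)) (nhds (vNEntropy A)) := by
  simp only [fun ε : ℝ => (h.diagonalizes.add_smul_one (c * ε)).vNEntropy_eq,
    h.diagonalizes.vNEntropy_eq]
  have : Continuous fun ε : ℝ => ∑ i, Real.negMulLog (h.eigenvalues i + c * ε) := by
    fun_prop
  have h0 := this.tendsto 0
  simp only [mul_zero, add_zero] at h0
  exact h0.mono_left nhdsWithin_le_nhds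

theorem Matrix.PosSemidef.sum_submatrix {ι m n : Type*} [Fintype ι] {X : Matrix m m ℂ}
    (h : X.PosSemidef) (f : ι → n → m) :
    (Matrix.of fun p q => ∑ k, X (f k p) (f k q)).PosSemidef := by
  have : (Matrix.of fun p q => ∑ k, X (f k p) (f k q)) = ∑ k, X.submatrix (f k) (f k) := by
    ext p q
    simp [Matrix.sum_apply]
  rw [this]
  exact posSemidef_sum _ fun k _ => h.submatrix _

theorem Matrix.PosSemidef.exists_eq_mul_conjTranspose {n : Type*} [Fintype n] [DecidableEq n]
    {A : Matrix n n ℂ} (h : A.PosSemidef) : ∃ K : Matrix n n ℂ, A = K * Kᴴ := by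
  have hd := h.isHermitian.diagonalizes
  refine ⟨(h.isHermitian.eigenvectorUnitary : Matrix n n ℂ) *
    diagonal (fun i => ((√(h.isHermitian.eigenvalues i) : ℝ) : ℂ)), ?_⟩
  conv_lhs => rw [hd.eq]
  simp only [conjTranspose_mul, diagonal_conjTranspose, mul_assoc]
  rw [← mul_assoc (diagonal _) (diagonal _), diagonal_mul_diagonal]
  congr 3
  ext i
  simp [← Complex.ofReal_mul, Real.mul_self_sqrt (h.eigenvalues_nonneg i)]

set_option linter.unusedSectionVars false

section RelativeEntropy

variable {n : Type*} [Fintype n] [DecidableEq n] {R S U V : Matrix n n ℂ} {p q : n → ℝ}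

/-- The quadratic functional whose supremum over `Y` is the resolvent sum
`∑ |(Vᴴ U) j i|² p i² / (q j + t p i)`. -/
noncomputable def resolventForm (R S : Matrix n n ℂ) (t : ℝ) (Y : Matrix n n ℂ) : ℝ :=
  2 * (trace (R * Y)).re - (trace (S * (Y * Yᴴ))).re - t * (trace (R * (Yᴴ * Y))).re

/-- The overlap-weighted resolvent sum of two spectra. -/
noncomputable def resolventSum (W : Matrix n n ℂ) (p q : n → ℝ) (t : ℝ) : ℝ :=
  ∑ j, ∑ i, Complex.normSq (W j i) * (p i ^ 2 / (q j + t * p i))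

theorem resolventForm_eq (hR : Diagonalizes R U p) (hS : Diagonalizes S V q) (t : ℝ)
    (Z : Matrix n n ℂ) :
    resolventForm R S t (V * Z * Uᴴ) = ∑ j, ∑ i,
      (2 * p i * (star ((Vᴴ * U) j i) * Z j i).re - (q j + t * p i) * Complex.normSq (Z j i)) := by
  have hU : ∀ X : Matrix n n ℂ, Uᴴ * (U * X) = X := fun X => by
    rw [← mul_assoc, hR.conj_mul, one_mul]
  have hV : ∀ X : Matrix n n ℂ, Vᴴ * (V * X) = X := fun X => by
    rw [← mul_assoc, hS.conj_mul, one_mul]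
  have h1 : trace (R * (V * Z * Uᴴ)) =
      trace (diagonal (fun i => (p i : ℂ)) * ((Vᴴ * U)ᴴ * Z)) := by
    rw [hR.eq, ← mul_assoc, trace_mul_comm]
    simp only [conjTranspose_mul, conjTranspose_conjTranspose, mul_assoc, hU]
  have h2 : trace (S * (V * Z * Uᴴ * (V * Z * Uᴴ)ᴴ)) =
      trace (diagonal (fun i => (q i : ℂ)) * (Z * Zᴴ)) := by
    rw [hS.eq, mul_assoc, mul_assoc, trace_mul_comm]
    simp only [conjTranspose_mul, conjTranspose_conjTranspose, mul_assoc, hU, hV, hS.conj_mul,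
      mul_one]
  have h3 : trace (R * ((V * Z * Uᴴ)ᴴ * (V * Z * Uᴴ))) =
      trace (diagonal (fun i => (p i : ℂ)) * (Zᴴ * Z)) := by
    rw [hR.eq, mul_assoc, mul_assoc, trace_mul_comm]
    simp only [conjTranspose_mul, conjTranspose_conjTranspose, mul_assoc, hU, hV, hR.conj_mul,
      mul_one]
  have e1 : (trace (R * (V * Z * Uᴴ))).re =
      ∑ j, ∑ i, p i * (star ((Vᴴ * U) j i) * Z j i).re := by
    rw [h1, Finset.sum_comm, trace, Complex.re_sum]
    refine Finset.sum_congr rfl fun i _ => ?_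
    rw [diag_apply, diagonal_mul, Complex.re_ofReal_mul, mul_apply, Complex.re_sum,
      Finset.mul_sum]
    simp only [conjTranspose_apply]
  have e2 : (trace (S * (V * Z * Uᴴ * (V * Z * Uᴴ)ᴴ))).re =
      ∑ j, ∑ i, q j * Complex.normSq (Z j i) := by
    rw [h2, trace, Complex.re_sum]
    refine Finset.sum_congr rfl fun i _ => ?_
    rw [diag_apply, diagonal_mul, Complex.re_ofReal_mul, mul_apply, Complex.re_sum,
      Finset.mul_sum]
    simp [conjTranspose_apply, Complex.normSq_apply]
  have e3 : (trace (R * ((V * Z * Uᴴ)ᴴ * (V * Z * Uᴴ)))).re =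
      ∑ j, ∑ i, p i * Complex.normSq (Z j i) := by
    rw [h3, Finset.sum_comm, trace, Complex.re_sum]
    refine Finset.sum_congr rfl fun i _ => ?_
    rw [diag_apply, diagonal_mul, Complex.re_ofReal_mul, mul_apply, Complex.re_sum,
      Finset.mul_sum]
    simp [conjTranspose_apply, Complex.normSq_apply]
  rw [resolventForm, e1, e2, e3]
  simp only [Finset.mul_sum, ← Finset.sum_sub_distrib]
  refine Finset.sum_congr rfl fun j _ => Finset.sum_congr rfl fun i _ => ?_
  ring

theorem resolventForm_le (hR : Diagonalizes R U p) (hS : Diagonalizes S V q)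
    (hp : ∀ i, 0 < p i) (hq : ∀ i, 0 < q i) {t : ℝ} (ht : 0 ≤ t) (Y : Matrix n n ℂ) :
    resolventForm R S t Y ≤ resolventSum (Vᴴ * U) p q t := by
  have hY : Y = V * (Vᴴ * Y * U) * Uᴴ := by
    rw [show V * (Vᴴ * Y * U) * Uᴴ = (V * Vᴴ) * Y * (U * Uᴴ) by simp only [mul_assoc],
      hR.mul_conj, hS.mul_conj, one_mul, mul_one]
  rw [hY, resolventForm_eq hR hS]
  refine Finset.sum_le_sum fun j _ => Finset.sum_le_sum fun i _ => ?_
  generalize (Vᴴ * U) j i = w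
  generalize (Vᴴ * Y * U) j i = z
  have hs : 0 < q j + t * p i := add_pos_of_pos_of_nonneg (hq j) (mul_nonneg ht (hp i).le)
  generalize q j + t * p i = s at hs
  rw [← mul_div_assoc, le_div_iff₀ hs]
  simp only [Complex.normSq_apply, Complex.mul_re, Complex.star_def, Complex.conj_re,
    Complex.conj_im]
  nlinarith [sq_nonneg (s * z.re - p i * w.re), sq_nonneg (s * z.im - p i * w.im)]

theorem exists_resolventForm_eq (hR : Diagonalizes R U p) (hS : Diagonalizes S V q)
    (hp : ∀ i, 0 < p i) (hq : ∀ i, 0 < q i) {t : ℝ} (ht : 0 ≤ t) :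
    ∃ Y, resolventForm R S t Y = resolventSum (Vᴴ * U) p q t := by
  refine ⟨V * (Matrix.of fun j i => ((p i / (q j + t * p i) : ℝ) : ℂ) * (Vᴴ * U) j i) * Uᴴ, ?_⟩
  rw [resolventForm_eq hR hS]
  refine Finset.sum_congr rfl fun j _ => Finset.sum_congr rfl fun i _ => ?_
  have hs : 0 < q j + t * p i := add_pos_of_pos_of_nonneg (hq j) (mul_nonneg ht (hp i).le)
  rw [of_apply]
  generalize (Vᴴ * U) j i = w
  generalize q j + t * p i = s at hs
  rw [Complex.normSq_mul, Complex.normSq_ofReal]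
  simp only [Complex.normSq_apply, Complex.mul_re, Complex.star_def, Complex.conj_re,
    Complex.conj_im, Complex.mul_im, Complex.ofReal_re, Complex.ofReal_im, zero_mul, sub_zero,
    add_zero]
  field_simp
  ring

/-- The overlap-weighted logarithmic sum, an antiderivative of `resolventSum`. -/
noncomputable def logSum (W : Matrix n n ℂ) (p q : n → ℝ) (t : ℝ) : ℝ :=
  ∑ j, ∑ i, Complex.normSq (W j i) * (p i * Real.log (q j + t * p i))

theorem hasDerivAt_logSum (W : Matrix n n ℂ) (hp : ∀ i, 0 < p i) (hq : ∀ i, 0 < q i) {t : ℝ}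
    (ht : 0 ≤ t) : HasDerivAt (logSum W p q) (resolventSum W p q t) t := by
  unfold logSum resolventSum
  refine HasDerivAt.fun_sum fun j _ => HasDerivAt.fun_sum fun i _ => HasDerivAt.const_mul _ ?_
  have hs : 0 < q j + t * p i := add_pos_of_pos_of_nonneg (hq j) (mul_nonneg ht (hp i).le)
  have := ((((hasDerivAt_id' t).mul_const (p i)).const_add (q j)).log hs.ne').const_mul (p i)
  convert this using 1
  rw [one_mul, mul_div_assoc', sq]

theorem sum_normSq_col {W : Matrix n n ℂ} (hW : Wᴴ * W = 1) (i : n) :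
    ∑ j, Complex.normSq (W j i) = 1 := by
  have h := congrArg Complex.re (congrFun (congrFun hW i) i)
  rw [mul_apply, Complex.re_sum] at h
  simpa [Complex.normSq_apply] using h

theorem sum_normSq_mul {W : Matrix n n ℂ} (hW : Wᴴ * W = 1) (f : n → ℝ) :
    ∑ j, ∑ i, Complex.normSq (W j i) * f i = ∑ i, f i := by
  rw [Finset.sum_comm]
  simp only [← Finset.sum_mul, sum_normSq_col hW, one_mul]

theorem tendsto_logSum {W : Matrix n n ℂ} (hW : Wᴴ * W = 1)
    (hp : ∀ i, 0 < p i) (hq : ∀ i, 0 < q i) :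
    Filter.Tendsto (fun t => logSum W p q t - (∑ i, p i) * Real.log t) Filter.atTop
      (nhds (∑ i, p i * Real.log (p i))) := by
  have h : Filter.Tendsto
      (fun t : ℝ => ∑ j, ∑ i, Complex.normSq (W j i) * (p i * Real.log (q j / t + p i)))
      Filter.atTop (nhds (∑ j, ∑ i, Complex.normSq (W j i) * (p i * Real.log (p i)))) := by
    refine tendsto_finsetSum _ fun j _ => tendsto_finsetSum _ fun i _ =>
      (Filter.Tendsto.const_mul _ ?_).const_mul _
    have h0 : Filter.Tendsto (fun t : ℝ => q j / t + p i) Filter.atTop (nhds (0 + p i)) :=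
      (Filter.tendsto_id.const_div_atTop (q j)).add_const _
    rw [zero_add] at h0
    exact h0.log (hp i).ne'
  rw [sum_normSq_mul hW fun i => p i * Real.log (p i)] at h
  refine h.congr' ?_
  filter_upwards [Filter.eventually_gt_atTop 0] with t ht
  rw [Finset.sum_mul, ← sum_normSq_mul hW fun i => p i * Real.log t, logSum, ← Finset.sum_sub_distrib]
  refine Finset.sum_congr rfl fun j _ => ?_
  rw [← Finset.sum_sub_distrib]
  refine Finset.sum_congr rfl fun i _ => ?_
  have hs : 0 < q j + t * p i := add_pos (hq j) (mul_pos ht (hp i))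
  rw [show q j / t + p i = (q j + t * p i) / t by field_simp, Real.log_div hs.ne' ht.ne']
  ring

theorem logSum_zero (hR : Diagonalizes R U p) :
    logSum (Vᴴ * U) p q 0 =
      (trace (R * (V * diagonal (fun i => (Real.log (q i) : ℂ)) * Vᴴ))).re := by
  have h : trace (R * (V * diagonal (fun i => (Real.log (q i) : ℂ)) * Vᴴ)) =
      trace (diagonal (fun i => (Real.log (q i) : ℂ)) *
        ((Vᴴ * U) * (diagonal (fun i => (p i : ℂ)) * (Vᴴ * U)ᴴ))) := by
    rw [hR.eq, trace_mul_comm, mul_assoc, mul_assoc, trace_mul_comm V]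
    simp only [conjTranspose_mul, conjTranspose_conjTranspose, mul_assoc]
  rw [h, trace, Complex.re_sum, logSum]
  refine Finset.sum_congr rfl fun j _ => ?_
  rw [diag_apply, diagonal_mul, Complex.re_ofReal_mul, mul_apply, Complex.re_sum, Finset.mul_sum]
  refine Finset.sum_congr rfl fun i _ => ?_
  rw [diagonal_mul, mul_left_comm ((Vᴴ * U) j i), Complex.re_ofReal_mul, conjTranspose_apply, Complex.star_def,
    Complex.mul_conj, Complex.ofReal_re]
  simp only [zero_mul, add_zero]
  ring

/-- Monotonicity of the relative entropy under restriction to a star-closed subalgebra, given as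
the image of `e`. -/
theorem relEntropy_mono {m : Type*} [Fintype m] [DecidableEq m]
    {R' S' U' V' : Matrix m m ℂ} {p' q' : m → ℝ}
    (hR : Diagonalizes R U p) (hS : Diagonalizes S V q)
    (hR' : Diagonalizes R' U' p') (hS' : Diagonalizes S' V' q')
    (hp : ∀ i, 0 < p i) (hq : ∀ i, 0 < q i) (hp' : ∀ i, 0 < p' i) (hq' : ∀ i, 0 < q' i)
    (e : Matrix m m ℂ → Matrix n n ℂ) (e_mul : ∀ X Y, e (X * Y) = e X * e Y)
    (e_star : ∀ X, e Xᴴ = (e X)ᴴ) (e_one : e 1 = 1)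
    (hRe : ∀ Y, trace (R * e Y) = trace (R' * Y)) (hSe : ∀ Y, trace (S * e Y) = trace (S' * Y)) :
    (∑ i, p' i * Real.log (p' i)) -
        (trace (R' * (V' * diagonal (fun i => (Real.log (q' i) : ℂ)) * V'ᴴ))).re ≤
      (∑ i, p i * Real.log (p i)) -
        (trace (R * (V * diagonal (fun i => (Real.log (q i) : ℂ)) * Vᴴ))).re := by
  have unitary : (Vᴴ * U)ᴴ * (Vᴴ * U) = 1 := by
    rw [conjTranspose_mul, conjTranspose_conjTranspose, mul_assoc, ← mul_assoc V, hS.mul_conj,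
      one_mul, hR.conj_mul]
  have unitary' : (V'ᴴ * U')ᴴ * (V'ᴴ * U') = 1 := by
    rw [conjTranspose_mul, conjTranspose_conjTranspose, mul_assoc, ← mul_assoc V', hS'.mul_conj,
      one_mul, hR'.conj_mul]
  have hsum : ∑ i, p i = ∑ i, p' i := by
    have h1 := congrArg Complex.re (hRe 1)
    rw [e_one, mul_one, mul_one, hR.eq, hR'.eq, mul_assoc, mul_assoc, trace_mul_comm,
      trace_mul_comm U', mul_assoc, mul_assoc, hR.conj_mul, hR'.conj_mul] at h1
    simpa [trace_diagonal] using h1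
  have hle : ∀ t, 0 ≤ t → resolventSum (V'ᴴ * U') p' q' t ≤ resolventSum (Vᴴ * U) p q t := by
    intro t ht
    obtain ⟨Y, hY⟩ := exists_resolventForm_eq hR' hS' hp' hq' ht
    rw [← hY]
    convert resolventForm_le hR hS hp hq ht (e Y) using 1
    simp only [resolventForm, ← e_star, ← e_mul, hRe, hSe]
  have hderiv : ∀ t, 0 ≤ t →
      HasDerivAt (fun s => logSum (Vᴴ * U) p q s - logSum (V'ᴴ * U') p' q' s)
        (resolventSum (Vᴴ * U) p q t - resolventSum (V'ᴴ * U') p' q' t) t := fun t ht =>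
    (hasDerivAt_logSum _ hp hq ht).sub (hasDerivAt_logSum _ hp' hq' ht)
  have hmono : MonotoneOn (fun s => logSum (Vᴴ * U) p q s - logSum (V'ᴴ * U') p' q' s)
      (Set.Ici 0) := by
    refine monotoneOn_of_deriv_nonneg (convex_Ici 0)
      (fun t ht => (hderiv t ht).continuousAt.continuousWithinAt) ?_ ?_ <;>
    · intro t ht
      rw [interior_Ici] at ht
      first
        | exact (hderiv t (le_of_lt ht)).differentiableAt.differentiableWithinAt
        | rw [(hderiv t (le_of_lt ht)).deriv]
          exact sub_nonneg.mpr (hle t (le_of_lt ht))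
  have hlim := (tendsto_logSum unitary hp hq).sub (tendsto_logSum unitary' hp' hq')
  have hfin : logSum (Vᴴ * U) p q 0 - logSum (V'ᴴ * U') p' q' 0 ≤
      (∑ i, p i * Real.log (p i)) - ∑ i, p' i * Real.log (p' i) := by
    refine ge_of_tendsto hlim ?_
    filter_upwards [Filter.eventually_ge_atTop 0] with t ht
    have := hmono (Set.mem_Ici.mpr le_rfl) (Set.mem_Ici.mpr ht) ht
    rw [hsum]
    simp only at this
    linarith
  rw [logSum_zero hR, logSum_zero hR'] at hfin
  linarith

end RelativeEntropy

section StrongSubadditivity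

open scoped Kronecker

variable {C D E : Type*} [Fintype C] [DecidableEq C] [Fintype D] [DecidableEq D]
  [Fintype E] [DecidableEq E]

/-- The partial trace over the first tensor factor. -/
noncomputable def traceFst (X : Matrix (C × D) (C × D) ℂ) : Matrix D D ℂ :=
  Matrix.of fun p q => ∑ c, X (c, p) (c, q)

/-- The partial trace over the third of three tensor factors. -/
noncomputable def traceThird (X : Matrix (C × D × E) (C × D × E) ℂ) :
    Matrix (C × D) (C × D) ℂ :=
  Matrix.of fun p q => ∑ e, X (p.1, p.2, e) (q.1, q.2, e)

/-- The ampliation `Y ↦ Y ⊗ 1` onto three tensor factors. -/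
noncomputable def ampliation (E : Type*) [DecidableEq E]
    (Y : Matrix (C × D) (C × D) ℂ) : Matrix (C × D × E) (C × D × E) ℂ :=
  (Y ⊗ₖ (1 : Matrix E E ℂ)).submatrix (Equiv.prodAssoc C D E).symm (Equiv.prodAssoc C D E).symm

theorem ampliation_mul (X Y : Matrix (C × D) (C × D) ℂ) :
    ampliation E (X * Y) = ampliation E X * ampliation E Y := by
  rw [ampliation, ampliation, ampliation, submatrix_mul_equiv, ← mul_kronecker_mul, one_mul]

theorem ampliation_conjTranspose (X : Matrix (C × D) (C × D) ℂ) :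
    ampliation E Xᴴ = (ampliation E X)ᴴ := by
  rw [ampliation, ampliation, conjTranspose_submatrix, conjTranspose_kronecker, conjTranspose_one]

theorem ampliation_one : ampliation E (1 : Matrix (C × D) (C × D) ℂ) = 1 := by
  rw [ampliation, one_kronecker_one, submatrix_one_equiv]

theorem trace_mul_ampliation (X : Matrix (C × D × E) (C × D × E) ℂ)
    (Y : Matrix (C × D) (C × D) ℂ) :
    trace (X * ampliation E Y) = trace (traceThird X * Y) := by
  have hl : trace (X * ampliation E Y) = ∑ c, ∑ d, ∑ e, ∑ c', ∑ d',
      X (c, d, e) (c', d', e) * Y (c', d') (c, d) := by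
    simp [trace, mul_apply, ampliation, Fintype.sum_prod_type, one_apply]
  rw [hl]
  simp only [trace, mul_apply, traceThird, Fintype.sum_prod_type, diag_apply, of_apply,
    Finset.sum_mul]
  refine Finset.sum_congr rfl fun c _ => Finset.sum_congr rfl fun d _ => ?_
  rw [Finset.sum_comm]
  exact Finset.sum_congr rfl fun c' _ => Finset.sum_comm

theorem trace_mul_one_kronecker (X : Matrix (C × D) (C × D) ℂ) (L : Matrix D D ℂ) :
    trace (X * ((1 : Matrix C C ℂ) ⊗ₖ L)) = trace (traceFst X * L) := by
  have hl : trace (X * ((1 : Matrix C C ℂ) ⊗ₖ L)) =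
      ∑ c, ∑ d, ∑ d', X (c, d) (c, d') * L d' d := by
    simp only [trace, mul_apply, Fintype.sum_prod_type, diag_apply, kroneckerMap_apply, one_apply]
    refine Finset.sum_congr rfl fun c _ => Finset.sum_congr rfl fun d _ => ?_
    rw [Finset.sum_eq_single c]
    · simp
    · intro c' _ hc
      simp [hc]
    · simp
  rw [hl]
  simp only [trace, mul_apply, traceFst, diag_apply, of_apply, Finset.sum_mul]
  rw [Finset.sum_comm]
  exact Finset.sum_congr rfl fun d _ => Finset.sum_comm

theorem traceThird_one_kronecker (X : Matrix (D × E) (D × E) ℂ) :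
    traceThird ((1 : Matrix C C ℂ) ⊗ₖ X) =
      (1 : Matrix C C ℂ) ⊗ₖ (Matrix.of fun d d' => ∑ e, X (d, e) (d', e)) := by
  ext p q
  simp [traceThird, Finset.mul_sum]

theorem Diagonalizes.one_kronecker {A V : Matrix D D ℂ} {q : D → ℝ} (h : Diagonalizes A V q) :
    Diagonalizes ((1 : Matrix C C ℂ) ⊗ₖ A) ((1 : Matrix C C ℂ) ⊗ₖ V) fun x => q x.2 := by
  constructor
  · rw [conjTranspose_kronecker, ← mul_kronecker_mul, h.conj_mul, conjTranspose_one, one_mul,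
      one_kronecker_one]
  · have : (diagonal fun x : C × D => ((q x.2 : ℝ) : ℂ)) =
        (1 : Matrix C C ℂ) ⊗ₖ diagonal fun i => (q i : ℂ) := by
      rw [← diagonal_one, diagonal_kronecker_diagonal]
      simp
    rw [this, conjTranspose_kronecker, ← mul_kronecker_mul, ← mul_kronecker_mul, ← h.eq,
      conjTranspose_one, one_mul, one_mul]

theorem Diagonalizes.trace_mul_log {A V : Matrix D D ℂ} {q : D → ℝ} (h : Diagonalizes A V q) :
    (trace (A * (V * diagonal (fun i => (Real.log (q i) : ℂ)) * Vᴴ))).re = -vNEntropy A := by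
  have h1 : trace (A * (V * diagonal (fun i => (Real.log (q i) : ℂ)) * Vᴴ)) =
      trace (Vᴴ * A * V * diagonal (fun i => (Real.log (q i) : ℂ))) := by
    rw [← mul_assoc, trace_mul_comm]
    simp only [mul_assoc]
  rw [h1, h.conj_mul_mul, diagonal_mul_diagonal, trace_diagonal, Complex.re_sum, h.vNEntropy_eq,
    ← Finset.sum_neg_distrib]
  simp [Real.negMulLog]

theorem Diagonalizes.trace_mul_log_kronecker {X : Matrix (C × D) (C × D) ℂ} {V : Matrix D D ℂ}
    {q : D → ℝ} (h : Diagonalizes (traceFst X) V q) :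
    (trace (X * ((1 : Matrix C C ℂ) ⊗ₖ V *
      diagonal (fun x : C × D => (Real.log (q x.2) : ℂ)) * ((1 : Matrix C C ℂ) ⊗ₖ V)ᴴ))).re =
      -vNEntropy (traceFst X) := by
  have : (diagonal fun x : C × D => (Real.log (q x.2) : ℂ)) =
      (1 : Matrix C C ℂ) ⊗ₖ diagonal fun i => (Real.log (q i) : ℂ) := by
    rw [← diagonal_one, diagonal_kronecker_diagonal]
    simp
  rw [this, conjTranspose_kronecker, ← mul_kronecker_mul, ← mul_kronecker_mul, conjTranspose_one,
    one_mul, one_mul, trace_mul_one_kronecker, h.trace_mul_log]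

theorem Diagonalizes.sum_mul_log {A V : Matrix D D ℂ} {q : D → ℝ} (h : Diagonalizes A V q) :
    ∑ i, q i * Real.log (q i) = -vNEntropy A := by
  rw [h.vNEntropy_eq, ← Finset.sum_neg_distrib]
  simp [Real.negMulLog]

theorem strong_subadditivity_of_pos {X U : Matrix (C × D × E) (C × D × E) ℂ}
    {U₁ : Matrix (C × D) (C × D) ℂ} {V : Matrix (D × E) (D × E) ℂ} {V₁ : Matrix D D ℂ}
    {p : C × D × E → ℝ} {p₁ : C × D → ℝ} {q : D × E → ℝ} {q₁ : D → ℝ}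
    (hX : Diagonalizes X U p) (hX₁ : Diagonalizes (traceThird X) U₁ p₁)
    (hY : Diagonalizes (traceFst X) V q) (hY₁ : Diagonalizes (traceFst (traceThird X)) V₁ q₁)
    (hp : ∀ i, 0 < p i) (hp₁ : ∀ i, 0 < p₁ i) (hq : ∀ i, 0 < q i) (hq₁ : ∀ i, 0 < q₁ i) :
    vNEntropy X - vNEntropy (traceFst X) ≤
      vNEntropy (traceThird X) - vNEntropy (traceFst (traceThird X)) := by
  have hS : traceThird ((1 : Matrix C C ℂ) ⊗ₖ traceFst X) =
      (1 : Matrix C C ℂ) ⊗ₖ traceFst (traceThird X) := by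
    rw [traceThird_one_kronecker]
    congr 1
    ext d d'
    exact Finset.sum_comm
  have key := relEntropy_mono hX hY.one_kronecker hX₁ hY₁.one_kronecker hp (fun i => hq i.2) hp₁
    (fun i => hq₁ i.2) (ampliation E) ampliation_mul ampliation_conjTranspose ampliation_one
    (trace_mul_ampliation X) (fun Y => by rw [trace_mul_ampliation, hS])
  rw [hX.sum_mul_log, hX₁.sum_mul_log, hY.trace_mul_log_kronecker,
    hY₁.trace_mul_log_kronecker] at key
  linarith

theorem traceFst_add_smul_one (X : Matrix (C × D) (C × D) ℂ) (ε : ℝ) :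
    traceFst (X + (ε : ℂ) • 1) = traceFst X + ((Fintype.card C * ε : ℝ) : ℂ) • 1 := by
  ext p q
  by_cases h : p = q <;> simp [traceFst, Finset.sum_add_distrib, one_apply, h]

theorem traceThird_add_smul_one (X : Matrix (C × D × E) (C × D × E) ℂ) (ε : ℝ) :
    traceThird (X + (ε : ℂ) • 1) = traceThird X + ((Fintype.card E * ε : ℝ) : ℂ) • 1 := by
  ext p q
  by_cases h : p = q
  · simp [traceThird, Finset.sum_add_distrib, one_apply, h]
  · have h0 : ∀ e : E, (1 : Matrix (C × D × E) (C × D × E) ℂ) (p.1, p.2, e) (q.1, q.2, e) = 0 :=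
      fun e => one_apply_ne fun he => h (by simpa [Prod.ext_iff] using he)
    simp [traceThird, h0, one_apply_ne h]

/-- Strong subadditivity of the von Neumann entropy: `S(C|DE) ≤ S(C|D)`. -/
theorem strong_subadditivity [Nonempty C] [Nonempty E]
    {X : Matrix (C × D × E) (C × D × E) ℂ} (hX : X.PosSemidef) :
    vNEntropy X - vNEntropy (traceFst X) ≤
      vNEntropy (traceThird X) - vNEntropy (traceFst (traceThird X)) := by
  have hF : (traceFst X).PosSemidef := hX.sum_submatrix fun c p => (c, p)
  have hT : (traceThird X).PosSemidef :=
    hX.sum_submatrix fun (e : E) (p : C × D) => (p.1, p.2, e)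
  have hFT : (traceFst (traceThird X)).PosSemidef := hT.sum_submatrix fun c p => (c, p)
  have hC : (0 : ℝ) < Fintype.card C := by exact_mod_cast Fintype.card_pos
  have hE : (0 : ℝ) < Fintype.card E := by exact_mod_cast Fintype.card_pos
  refine le_of_tendsto_of_tendsto
    ((tendsto_vNEntropy_add hX.isHermitian 1).sub
      (tendsto_vNEntropy_add hF.isHermitian (Fintype.card C)))
    ((tendsto_vNEntropy_add hT.isHermitian (Fintype.card E)).sub
      (tendsto_vNEntropy_add hFT.isHermitian (Fintype.card C * Fintype.card E))) ?_
  filter_upwards [self_mem_nhdsWithin] with ε hε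
  have hε : 0 < ε := hε
  have e1 := traceFst_add_smul_one X ε
  have e2 := traceThird_add_smul_one X ε
  have e3 : traceFst (traceThird (X + (ε : ℂ) • 1)) = traceFst (traceThird X) +
      ((Fintype.card C * Fintype.card E * ε : ℝ) : ℂ) • 1 := by
    rw [e2, traceFst_add_smul_one, mul_assoc]
  rw [one_mul, ← e1, ← e2, ← e3]
  refine strong_subadditivity_of_pos (hX.isHermitian.diagonalizes.add_smul_one ε)
    (e2 ▸ hT.isHermitian.diagonalizes.add_smul_one _)
    (e1 ▸ hF.isHermitian.diagonalizes.add_smul_one _)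
    (e3 ▸ hFT.isHermitian.diagonalizes.add_smul_one _) ?_ ?_ ?_ ?_ <;> intro i
  · exact add_pos_of_nonneg_of_pos (hX.eigenvalues_nonneg i) hε
  · exact add_pos_of_nonneg_of_pos (hT.eigenvalues_nonneg i) (by positivity)
  · exact add_pos_of_nonneg_of_pos (hF.eigenvalues_nonneg i) (by positivity)
  · exact add_pos_of_nonneg_of_pos (hFT.eigenvalues_nonneg i) (by positivity)

/-- Weak monotonicity of the von Neumann entropy: `0 ≤ S(C|B) + S(C|F)`. -/
theorem weak_monotonicity {B F : Type*} [Fintype B] [DecidableEq B] [Fintype F] [DecidableEq F]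
    [Nonempty B] [Nonempty C] [Nonempty F]
    {ρ : Matrix (B × C × F) (B × C × F) ℂ} (hρ : ρ.PosSemidef) :
    0 ≤ vNEntropy (traceThird ρ) -
        vNEntropy (Matrix.of fun b b' => ∑ c, ∑ f, ρ (b, c, f) (b', c, f)) +
      (vNEntropy (traceFst ρ) - vNEntropy (traceFst (traceFst ρ))) := by
  obtain ⟨K, rfl⟩ := hρ.exists_eq_mul_conjTranspose
  let N : Matrix B (C × F × (B × C × F)) ℂ := Matrix.of fun b x => K (b, x.1, x.2.1) x.2.2
  let M : Matrix (B × C) (F × (B × C × F)) ℂ := Matrix.of fun x y => K (x.1, x.2, y.1) y.2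
  have hssa := strong_subadditivity (X := Nᵀ * Nᵀᴴ) (posSemidef_self_mul_conjTranspose Nᵀ)
  have h1 : N * Nᴴ = Matrix.of fun b b' => ∑ c, ∑ f, (K * Kᴴ) (b, c, f) (b', c, f) := by
    ext b b'
    simp only [mul_apply, N, Fintype.sum_prod_type, of_apply, conjTranspose_apply]
  have h2 : M * Mᴴ = traceThird (K * Kᴴ) := by
    ext b b'
    simp only [mul_apply, M, Fintype.sum_prod_type, of_apply, conjTranspose_apply, traceThird]
  have h3 : traceFst (Nᵀ * Nᵀᴴ) = Mᵀ * Mᵀᴴ := by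
    ext x y
    simp only [traceFst, mul_apply, M, N, Fintype.sum_prod_type, of_apply, conjTranspose_apply,
      transpose_apply]
    exact Finset.sum_comm
  have h4 : traceThird (Nᵀ * Nᵀᴴ) = traceFst (K * Kᴴ) := by
    ext x y
    simp only [traceFst, traceThird, mul_apply, N, of_apply, conjTranspose_apply, transpose_apply]
    exact Finset.sum_comm
  rw [h4, h3, vNEntropy_transpose_mul, vNEntropy_transpose_mul, h1, h2] at hssa
  linarith

end StrongSubadditivity

/-- For a density matrix `ρ` on `H_B ⊗ H_C ⊗ H_D ⊗ H_D'`: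
if `S(CB) - S(B) + S(CD) - S(D) = 0` then `S(CB) - S(B) + S(CDD') - S(DD') = 0`
(extension of axiom A1: `S(C|B) + S(C|D)` is nonnegative and non-increasing in `D`). -/
theorem A1_extends_under_enlarging_D
    {B C D D' : Type*} [Fintype B] [DecidableEq B] [Fintype C] [DecidableEq C]
    [Fintype D] [DecidableEq D] [Fintype D'] [DecidableEq D']
    (ρ : Matrix (B × C × D × D') (B × C × D × D') ℂ) (hρ : IsDensityMatrix ρ)
    (ρBC : Matrix (B × C) (B × C) ℂ)
    (hρBC : ρBC = Matrix.of fun p q =>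
      ∑ d : D, ∑ d' : D', ρ (p.1, p.2, d, d') (q.1, q.2, d, d'))
    (ρB : Matrix B B ℂ)
    (hρB : ρB = Matrix.of fun b b' =>
      ∑ c : C, ∑ d : D, ∑ d' : D', ρ (b, c, d, d') (b', c, d, d'))
    (ρCD : Matrix (C × D) (C × D) ℂ)
    (hρCD : ρCD = Matrix.of fun p q =>
      ∑ b : B, ∑ d' : D', ρ (b, p.1, p.2, d') (b, q.1, q.2, d'))
    (ρD : Matrix D D ℂ)
    (hρD : ρD = Matrix.of fun d d'' =>
      ∑ b : B, ∑ c : C, ∑ d' : D', ρ (b, c, d, d') (b, c, d'', d'))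
    (ρCDD' : Matrix (C × D × D') (C × D × D') ℂ)
    (hρCDD' : ρCDD' = Matrix.of fun p q => ∑ b : B, ρ (b, p) (b, q))
    (ρDD' : Matrix (D × D') (D × D') ℂ)
    (hρDD' : ρDD' = Matrix.of fun p q => ∑ b : B, ∑ c : C, ρ (b, c, p) (b, c, q))
    (hA1 : vNEntropy ρBC - vNEntropy ρB + vNEntropy ρCD - vNEntropy ρD = 0) :
    vNEntropy ρBC - vNEntropy ρB + vNEntropy ρCDD' - vNEntropy ρDD' = 0 := by
  have hne : Nonempty (B × C × D × D') := by
    by_contra h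
    rw [not_nonempty_iff] at h
    simpa [trace] using hρ.2
  obtain ⟨b, c, d, d'⟩ := hne
  have : Nonempty B := ⟨b⟩
  have : Nonempty C := ⟨c⟩
  have : Nonempty D := ⟨d⟩
  have : Nonempty D' := ⟨d'⟩
  have hF : (traceFst ρ).PosSemidef := hρ.1.sum_submatrix fun b p => (b, p)
  have hssa := strong_subadditivity hF
  have hwm := weak_monotonicity hρ.1
  have eBC : ρBC = traceThird ρ := by
    rw [hρBC]
    ext p q
    simp only [traceThird, of_apply, Fintype.sum_prod_type]
  have eB : ρB = Matrix.of fun b b' => ∑ c, ∑ f, ρ (b, c, f) (b', c, f) := by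
    rw [hρB]
    ext p q
    simp only [of_apply, Fintype.sum_prod_type]
  have eCD : ρCD = traceThird (traceFst ρ) := by
    rw [hρCD]
    ext p q
    exact Finset.sum_comm
  have eD : ρD = traceFst (traceThird (traceFst ρ)) := by
    rw [← eCD, hρD, hρCD]
    ext p q
    exact Finset.sum_comm
  have eCDD' : ρCDD' = traceFst ρ := hρCDD'
  have eDD' : ρDD' = traceFst (traceFst ρ) := by
    rw [hρDD']
    ext p q
    exact Finset.sum_comm
  rw [← eD, ← eCD, ← eDD', ← eCDD'] at hssa
  rw [← eBC, ← eB, ← eDD', ← eCDD'] at hwm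
  linarith
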